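/- Let d ≥ 1, c > 0, and let X : ℝ → ℝ × ℝ^d be a smooth curve (proper time τ) with η(X'(τ), X'(τ)) = −c² for all τ; write v = X', a = v', b = a', h = b'. Define the relativistic jerk j = b + (η(b, v)/c²) v and the relativistic snap s = j' + (η(j', v)/c²) v. Then for all τ, s = h − (η(a, a)/c²) a − 3 (η(a, b)/c²) v. -/

import Mathlib

open scoped RealInnerProductSpace

/-- The Minkowski inner product on `ℝ × ℝ^d`: `η((s,u),(r,w)) = −s r + u·w`. -/
noncomputable def minkowski {d : ℕ} (Z W : ℝ × EuclideanSpace ℝ (Fin d)) : ℝ :=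
  -(Z.1 * W.1) + ⟪Z.2, W.2⟫

theorem minkowski_comm {d : ℕ} (Z W : ℝ × EuclideanSpace ℝ (Fin d)) :
    minkowski Z W = minkowski W Z := by
  simp only [minkowski, real_inner_comm, mul_comm]

theorem minkowski_add_left {d : ℕ} (Z Y W : ℝ × EuclideanSpace ℝ (Fin d)) :
    minkowski (Z + Y) W = minkowski Z W + minkowski Y W := by
  simp only [minkowski, Prod.fst_add, Prod.snd_add, inner_add_left]
  ring

theorem minkowski_smul_left {d : ℕ} (r : ℝ) (Z W : ℝ × EuclideanSpace ℝ (Fin d)) :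
    minkowski (r • Z) W = r * minkowski Z W := by
  simp only [minkowski, Prod.smul_fst, Prod.smul_snd, real_inner_smul_left, smul_eq_mul]
  ring

theorem HasDerivAt.minkowski_apply {d : ℕ} {f g : ℝ → ℝ × EuclideanSpace ℝ (Fin d)}
    {f' g' : ℝ × EuclideanSpace ℝ (Fin d)} {t : ℝ}
    (hf : HasDerivAt f f' t) (hg : HasDerivAt g g' t) :
    HasDerivAt (fun t => minkowski (f t) (g t))
      (minkowski f' (g t) + minkowski (f t) g') t := by
  have fst_deriv {k : ℝ → ℝ × EuclideanSpace ℝ (Fin d)} {k'} (hk : HasDerivAt k k' t) :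
      HasDerivAt (fun t => (k t).1) k'.1 t :=
    (hasFDerivAt_fst (𝕜 := ℝ) (p := k t)).comp_hasDerivAt t hk
  have snd_deriv {k : ℝ → ℝ × EuclideanSpace ℝ (Fin d)} {k'} (hk : HasDerivAt k k' t) :
      HasDerivAt (fun t => (k t).2) k'.2 t :=
    (hasFDerivAt_snd (𝕜 := ℝ) (p := k t)).comp_hasDerivAt t hk
  refine (((fst_deriv hf).mul (fst_deriv hg)).neg.add
    ((snd_deriv hf).inner ℝ (snd_deriv hg))).congr_deriv ?_
  simp only [minkowski]
  ring

/-- For a proper-time parametrized worldline, the relativistic snap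
`s = j' + (η(j',v)/c²) v` equals `h − (η(a,a)/c²) a − 3(η(a,b)/c²) v`. -/
theorem relativistic_snap_formula (d : ℕ) (hd : 1 ≤ d) (c : ℝ) (hc : 0 < c)
    (X : ℝ → ℝ × EuclideanSpace ℝ (Fin d)) (hX : ContDiff ℝ (⊤ : ℕ∞) X)
    (v : ℝ → ℝ × EuclideanSpace ℝ (Fin d)) (hv : v = deriv X)
    (a : ℝ → ℝ × EuclideanSpace ℝ (Fin d)) (ha : a = deriv v)
    (b : ℝ → ℝ × EuclideanSpace ℝ (Fin d)) (hb : b = deriv a)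
    (h : ℝ → ℝ × EuclideanSpace ℝ (Fin d)) (hh : h = deriv b)
    (hnorm : ∀ τ : ℝ, minkowski (v τ) (v τ) = -c ^ 2)
    (j : ℝ → ℝ × EuclideanSpace ℝ (Fin d))
    (hj : ∀ τ, j τ = b τ + (minkowski (b τ) (v τ) / c ^ 2) • v τ)
    (s : ℝ → ℝ × EuclideanSpace ℝ (Fin d))
    (hs : ∀ τ, s τ = deriv j τ + (minkowski (deriv j τ) (v τ) / c ^ 2) • v τ) :
    ∀ τ : ℝ,
      s τ = h τ - (minkowski (a τ) (a τ) / c ^ 2) • a τ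
        - (3 * (minkowski (a τ) (b τ) / c ^ 2)) • v τ := by
  have hv_smooth : ContDiff ℝ (⊤ : ℕ∞) v := hv ▸ (contDiff_infty_iff_deriv.1 hX).2
  have ha_smooth : ContDiff ℝ (⊤ : ℕ∞) a := ha ▸ (contDiff_infty_iff_deriv.1 hv_smooth).2
  have hb_smooth : ContDiff ℝ (⊤ : ℕ∞) b := hb ▸ (contDiff_infty_iff_deriv.1 ha_smooth).2
  have hv_deriv (t : ℝ) : HasDerivAt v (a t) t :=
    ha ▸ ((contDiff_infty_iff_deriv.1 hv_smooth).1 t).hasDerivAt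
  have ha_deriv (t : ℝ) : HasDerivAt a (b t) t :=
    hb ▸ ((contDiff_infty_iff_deriv.1 ha_smooth).1 t).hasDerivAt
  have hb_deriv (t : ℝ) : HasDerivAt b (h t) t :=
    hh ▸ ((contDiff_infty_iff_deriv.1 hb_smooth).1 t).hasDerivAt
  have hav (t : ℝ) : minkowski (a t) (v t) = 0 := by
    have hderiv := (hv_deriv t).minkowski_apply (hv_deriv t)
    simp only [hnorm] at hderiv
    have heq := hderiv.unique (hasDerivAt_const t _)
    rw [minkowski_comm (v t)] at heq
    linarith
  have hbv (t : ℝ) : minkowski (b t) (v t) = -minkowski (a t) (a t) := by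
    have hderiv := (ha_deriv t).minkowski_apply (hv_deriv t)
    simp only [hav] at hderiv
    linarith [hderiv.unique (hasDerivAt_const t _)]
  have haa_deriv (t : ℝ) :
      HasDerivAt (fun t => -minkowski (a t) (a t)) (-(2 * minkowski (a t) (b t))) t := by
    refine ((ha_deriv t).minkowski_apply (ha_deriv t)).neg.congr_deriv ?_
    rw [minkowski_comm (b t)]
    ring
  have hhv (t : ℝ) : minkowski (h t) (v t) = -(3 * minkowski (a t) (b t)) := by
    have hderiv := (hb_deriv t).minkowski_apply (hv_deriv t)
    simp only [hbv] at hderiv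
    have heq := hderiv.unique (haa_deriv t)
    rw [minkowski_comm (b t)] at heq
    linarith
  intro τ
  have hj_deriv : deriv j τ = h τ + ((-minkowski (a τ) (a τ) / c ^ 2) • a τ +
      (-(2 * minkowski (a τ) (b τ)) / c ^ 2) • v τ) := by
    have hj_eq : j = fun t => b t + (-minkowski (a t) (a t) / c ^ 2) • v t := by
      funext t
      rw [hj, hbv]
    rw [hj_eq]
    exact ((hb_deriv τ).add (((haa_deriv τ).div_const (c ^ 2)).smul (hv_deriv τ))).deriv
  have hjv : minkowski (deriv j τ) (v τ) = -minkowski (a τ) (b τ) := by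
    simp only [hj_deriv, minkowski_add_left, minkowski_smul_left, hhv, hav, hnorm]
    field_simp
    ring
  rw [hs, hjv, hj_deriv]
  module
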